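/- arXiv:1711.10276 — 2 statements merged into one kernel-verified Lean document; each statement's English description precedes it below -/
import Mathlib

section
/- The curve K_0 is the unknot: there is an ambient isotopy between K_0 and the round circle {(x,y,0) : x² + y² = 1}. -/
open Set Real

noncomputable section

/-- Points in ℝ³. -/
abbrev V3 : Type := Fin 3 → ℝ

/-- The point (x, y, z) ∈ ℝ³. -/
def pt (x y z : ℝ) : V3 := ![x, y, z]

/-- Standard parameterization on `[0,1]` of the piecewise linear curve through
`P 0, P 1, …, P m`, traversing the `m` edges in order at constant speed. -/
def plPath (P : ℕ → V3) (m : ℕ) (t : ℝ) : V3 :=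
  let s := t * m
  let i := ⌊s⌋.toNat
  (1 - (s - i)) • P i + (s - i) • P (i + 1)

/-- An ambient isotopy between subsets `X` and `Y` of ℝ³: a continuous map
`H : ℝ³ × [0,1] → ℝ³` with `H(·,0) = id`, each `H(·,t)` a homeomorphism of ℝ³
onto itself, and `H(X × {1}) = Y`. -/
def AmbientIsotopic (X Y : Set V3) : Prop :=
  ∃ H : V3 → ℝ → V3,
    ContinuousOn (fun p : V3 × ℝ => H p.1 p.2) (univ ×ˢ Icc (0 : ℝ) 1) ∧
    (∀ x, H x 0 = x) ∧
    (∀ t ∈ Icc (0 : ℝ) 1, ∃ h : V3 ≃ₜ V3, ∀ x, H x t = h x) ∧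
    (fun x => H x 1) '' X = Y

/-- The round circle {(x, y, 0) : x² + y² = 1}. -/
def unitCircle : Set V3 := {p : V3 | ∃ x y : ℝ, x ^ 2 + y ^ 2 = 1 ∧ p = pt x y 0}

/-- The standard trefoil, the image of
`t ↦ ((2 + cos 3t) cos 2t, (2 + cos 3t) sin 2t, sin 3t)` for `t ∈ [0, 2π]`. -/
def trefoil : Set V3 :=
  {p : V3 | ∃ t ∈ Icc (0 : ℝ) (2 * π),
    p = pt ((2 + cos (3 * t)) * cos (2 * t)) ((2 + cos (3 * t)) * sin (2 * t)) (sin (3 * t))}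

/-- Cyclic vertex function determined by a list of points. -/
def vertsOf (L : List V3) : ℕ → V3 := fun m => L.getD (m % L.length) 0

/-- The vertices of the closed PL curve K₀. -/
def K0verts : List V3 :=
  [pt 0 9 20, pt (-15) (-95) (-50), pt 40 80 (-20), pt (-10) (-60) 58,
   pt (-60) 30 20, pt 40 (-60) (-60)]

/-- The vertices of the closed PL curve K₁ (the vertex (−10,−60,58) of K₀ is
replaced by (10,−60,58)). -/
def K1verts : List V3 :=
  [pt 0 9 20, pt (-15) (-95) (-50), pt 40 80 (-20), pt 10 (-60) 58,
   pt (-60) 30 20, pt 40 (-60) (-60)]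

/-- The standard loop parameterization of K₀. -/
def K0loop : ℝ → V3 := plPath (vertsOf K0verts) 6

/-- The standard loop parameterization of K₁. -/
def K1loop : ℝ → V3 := plPath (vertsOf K1verts) 6

/-- The closed PL curve K₀ as a subset of ℝ³. -/
def K0 : Set V3 := K0loop '' Icc 0 1

/-- The closed PL curve K₁ as a subset of ℝ³. -/
def K1 : Set V3 := K1loop '' Icc 0 1

/-- The de Casteljau points `P_i^{(k)}` at parameter 1/2:
`P_i^{(0)} = P_i` and `P_i^{(k)} = (P_i^{(k-1)} + P_{i+1}^{(k-1)})/2`. -/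
def dcQ (P : ℕ → V3) : ℕ → ℕ → V3
  | 0, i => P i
  | k + 1, i => (1 / 2 : ℝ) • (dcQ P k i + dcQ P k (i + 1))

/-- Left half of one de Casteljau subdivision step at parameter 1/2:
`(P_0^{(0)}, P_0^{(1)}, …, P_0^{(n)})`. -/
def dcLeft (P : ℕ → V3) : ℕ → V3 := fun i => dcQ P i 0

/-- Right half of one de Casteljau subdivision step at parameter 1/2 on a
degree-`n` control polygon: `(P_0^{(n)}, P_1^{(n-1)}, …, P_n^{(0)})`. -/
def dcRight (n : ℕ) (P : ℕ → V3) : ℕ → V3 := fun i => dcQ P (n - i) i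

/-- The list of `2^k` sub-control polygons, in order, produced by `k` iterations
of de Casteljau subdivision at parameter 1/2 on a degree-`n` control polygon. -/
def subPolys (n : ℕ) : ℕ → (ℕ → V3) → List (ℕ → V3)
  | 0, P => [P]
  | k + 1, P => subPolys n k (dcLeft P) ++ subPolys n k (dcRight n P)

/-- Vertex function (cyclic) of the concatenation, in order, of a list of
degree-`n` control polygons whose consecutive endpoints agree. -/
def concatVerts (n : ℕ) (L : List (ℕ → V3)) : ℕ → V3 :=
  fun m =>
    let m' := m % (n * L.length)
    (L.getD (m' / n) fun _ => 0) (m' % n)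

/-- The standard loop parameterization of the closed PL curve obtained from the
degree-6 control polygon `Q` by `k` iterations of de Casteljau subdivision at
parameter 1/2 (concatenating the `2^k` sub-control polygons in order). -/
def Ksub (k : ℕ) (Q : ℕ → V3) : ℝ → V3 :=
  plPath (concatVerts 6 (subPolys 6 k Q)) (6 * 2 ^ k)

/-- The Bézier curve of degree `n` with control points `P 0, …, P n`. -/
def bezier (n : ℕ) (P : ℕ → V3) (t : ℝ) : V3 :=
  ∑ i ∈ Finset.range (n + 1), ((n.choose i : ℝ) * t ^ i * (1 - t) ^ (n - i)) • P i

@[simp] theorem pt_apply_zero (x y z : ℝ) : pt x y z 0 = x := rfl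

@[simp] theorem pt_apply_one (x y z : ℝ) : pt x y z 1 = y := rfl

@[simp] theorem pt_apply_two (x y z : ℝ) : pt x y z 2 = z := rfl

theorem AmbientIsotopic.trans {X Y Z : Set V3} (hXY : AmbientIsotopic X Y)
    (hYZ : AmbientIsotopic Y Z) : AmbientIsotopic X Z := by
  obtain ⟨F, hFc, hF0, hFh, hF1⟩ := hXY
  obtain ⟨G, hGc, hG0, hGh, hG1⟩ := hYZ
  refine ⟨fun x t => G (F x t) t, ?_, fun x => by simp only [hF0, hG0], fun t ht => ?_, ?_⟩
  · exact hGc.comp (hFc.prodMk continuousOn_snd) fun p hp => ⟨mem_univ _, hp.2⟩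
  · obtain ⟨f, hf⟩ := hFh t ht
    obtain ⟨g, hg⟩ := hGh t ht
    exact ⟨f.trans g, fun x => by simp [hf, hg]⟩
  · rw [← hG1, ← hF1, image_image]

/-- Displacing points in the direction `d` by a continuous amount whose rate of decrease along `d`
is less than one is a homeomorphism. -/
theorem exists_homeomorph_add_smul {f : V3 → ℝ} (hf : Continuous f) (d : V3) {c : ℝ} (hc : c < 1)
    (hslope : ∀ x s, 0 ≤ s → f x - c * s ≤ f (x + s • d)) :
    ∃ h : V3 ≃ₜ V3, ∀ x, h x = x + f x • d := by
  let g : V3 → V3 := fun x => x + f x • d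
  have hg : Continuous g := by fun_prop
  let m : V3 → ℝ → ℝ := fun x s => s + f (x + s • d)
  have hm (x : V3) (s s' : ℝ) (hs : s ≤ s') : (1 - c) * (s' - s) ≤ m x s' - m x s := by
    have h := hslope (x + s • d) (s' - s) (by linarith)
    rw [show x + s • d + (s' - s) • d = x + s' • d by module] at h
    simp only [m]
    linarith
  have hgm (x : V3) (s : ℝ) : g (x + s • d) = x + m x s • d := by
    simp only [g, m]
    module
  have hm_dist (x : V3) (s s' : ℝ) : (1 - c) * |s' - s| ≤ |m x s' - m x s| := by
    rcases le_total s s' with h | h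
    · rw [abs_of_nonneg (sub_nonneg.2 h)]
      exact (hm x s s' h).trans (le_abs_self _)
    · rw [abs_sub_comm, abs_of_nonneg (sub_nonneg.2 h), abs_sub_comm]
      exact (hm x s' s h).trans (le_abs_self _)
  have hm_cont (x : V3) : Continuous (m x) := by fun_prop
  have hm_surj (x : V3) : Function.Surjective (m x) := by
    refine (hm_cont x).surjective ?_ ?_
    · refine Filter.tendsto_atTop_mono' _ ?_ (Filter.tendsto_atTop_add_const_right _ (m x 0)
        (Filter.tendsto_id.const_mul_atTop (sub_pos.2 hc)))
      filter_upwards [Filter.eventually_ge_atTop 0] with s hs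
      have := hm x 0 s hs
      simp only [id]
      linarith
    · refine Filter.tendsto_atBot_mono' _ ?_ (Filter.tendsto_atBot_add_const_right _ (m x 0)
        (Filter.tendsto_id.const_mul_atBot (sub_pos.2 hc)))
      filter_upwards [Filter.eventually_le_atBot 0] with s hs
      have := hm x s 0 hs
      simp only [id]
      linarith
  have hg_surj : Function.Surjective g := fun y => by
    obtain ⟨s, hs⟩ := hm_surj y 0
    exact ⟨y + s • d, by rw [hgm, hs]; simp⟩
  have hm_inj (x : V3) {s s' : ℝ} (h : m x s = m x s') : s = s' := by
    have h1 := hm_dist x s s'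
    rw [h, sub_self, abs_zero] at h1
    have h2 : |s' - s| ≤ 0 := by
      by_contra! h3
      linarith [mul_pos (sub_pos.2 hc) h3]
    linarith [abs_nonpos_iff.1 h2]
  have hg_inj : Function.Injective g := fun x y hxy => by
    have hxy' : x + f x • d = y + f y • d := hxy
    have hx : x = y + (f y - f x) • d := by
      rw [sub_smul, ← add_sub_assoc, ← hxy', add_sub_cancel_right]
    have h1 : f y = m y (f y - f x) := by
      simp only [m]
      rw [← hx]
      ring
    have h2 : m y 0 = f y := by simp [m]
    have h3 := hm_inj y (h2.trans h1)
    rw [hx, ← h3]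
    simp
  let e : V3 ≃ V3 := Equiv.ofBijective g ⟨hg_inj, hg_surj⟩
  have he (x : V3) : e x = x + f x • d := rfl
  have hsymm (z : V3) : g (e.symm z) = z := e.apply_symm_apply z
  refine ⟨⟨e, hg, ?_⟩, he⟩
  change Continuous e.symm
  rw [continuous_iff_continuousAt]
  intro y
  let x := e.symm y
  have hx : x + f x • d = y := hsymm y
  -- `z - f x • d` and the preimage of `z` lie on the same line of direction `d`
  let r : V3 → ℝ := fun z => f x - f (e.symm z)
  have hr (z : V3) : e.symm z = (z - f x • d) + r z • d := by
    have h : e.symm z + f (e.symm z) • d = z := hsymm z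
    simp only [r]
    rw [sub_smul, sub_add_sub_cancel, eq_sub_iff_add_eq, h]
  have hr_bound (z : V3) : |r z| ≤ (1 - c)⁻¹ * |f x - f (z - f x • d)| := by
    have h1 := hm_dist (z - f x • d) 0 (r z)
    have h2 : m (z - f x • d) (r z) = f x := by
      simp only [m]
      rw [← hr]
      simp [r]
    have h3 : m (z - f x • d) 0 = f (z - f x • d) := by simp [m]
    rw [h2, h3, sub_zero] at h1
    rwa [inv_mul_eq_div, le_div_iff₀' (sub_pos.2 hc)]
  have hr_tendsto : Filter.Tendsto r (nhds y) (nhds 0) := by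
    refine squeeze_zero_norm hr_bound ?_
    have h : Continuous fun z : V3 => (1 - c)⁻¹ * |f x - f (z - f x • d)| := by fun_prop
    have h' := h.tendsto y
    rwa [show y - f x • d = x by rw [← hx, add_sub_cancel_right], sub_self, abs_zero,
      mul_zero] at h'
  have h : Filter.Tendsto (fun z => (z - f x • d) + r z • d) (nhds y)
      (nhds ((y - f x • d) + (0 : ℝ) • d)) :=
    (Continuous.tendsto (by fun_prop) y).add (hr_tendsto.smul_const d)
  rw [zero_smul, add_zero, show y - f x • d = x by rw [← hx, add_sub_cancel_right]] at h
  exact h.congr fun z => (hr z).symm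

theorem ambientIsotopic_image_add_smul {f : V3 → ℝ} (hf : Continuous f) (d : V3) {c : ℝ}
    (hc : c < 1) (hslope : ∀ x s, 0 ≤ s → f x - c * s ≤ f (x + s • d)) (X : Set V3) :
    AmbientIsotopic X ((fun x => x + f x • d) '' X) := by
  refine ⟨fun x t => x + (t * f x) • d, by fun_prop, by simp, fun t ht => ?_, by simp⟩
  have hc' : t * c < 1 := by
    rcases ht.1.eq_or_lt with rfl | h0
    · simp
    · nlinarith [ht.2]
  obtain ⟨h, hh⟩ := exists_homeomorph_add_smul (f := fun x => t * f x) (by fun_prop) d hc'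
    fun x s hs => by nlinarith [hslope x s hs, ht.1]
  exact ⟨h, fun x => (hh x).symm⟩

theorem image_segment_add_smul {f : V3 → ℝ} {u v v' : V3}
    (huv : ∀ s ∈ Icc (0 : ℝ) 1, f (u + s • (v - u)) = s) :
    (fun x => x + f x • (v' - v)) '' segment ℝ u v = segment ℝ u v' := by
  rw [segment_eq_image', segment_eq_image', image_image]
  refine image_congr fun s hs => ?_
  rw [huv s hs]
  module

/-- Moving the vertex `v` of a polygonal curve to `v'`, keeping the remainder `X` fixed. -/
theorem ambientIsotopic_move_vertex {f : V3 → ℝ} (hf : Continuous f) {X : Set V3} {u v w : V3}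
    (v' : V3) {c : ℝ} (hc : c < 1)
    (hslope : ∀ x s, 0 ≤ s → f x - c * s ≤ f (x + s • (v' - v)))
    (hX : ∀ p ∈ X, f p = 0)
    (huv : ∀ s ∈ Icc (0 : ℝ) 1, f (u + s • (v - u)) = s)
    (hwv : ∀ s ∈ Icc (0 : ℝ) 1, f (w + s • (v - w)) = s) :
    AmbientIsotopic (X ∪ (segment ℝ u v ∪ segment ℝ v w))
      (X ∪ (segment ℝ u v' ∪ segment ℝ v' w)) := by
  have h := ambientIsotopic_image_add_smul hf (v' - v) hc hslope
    (X ∪ (segment ℝ u v ∪ segment ℝ v w))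
  rw [image_union, image_union, segment_symm ℝ v w, image_segment_add_smul huv,
    image_segment_add_smul hwv, segment_symm ℝ w v',
    show (fun x => x + f x • (v' - v)) '' X = X from
      (image_congr fun p hp => by simp [hX p hp]).trans (image_id' X)] at h
  rwa [segment_symm ℝ v w]

/-- The affine function with gradient `n` and constant term `e`. -/
def affineFn (n : V3) (e : ℝ) (p : V3) : ℝ := n 0 * p 0 + n 1 * p 1 + n 2 * p 2 + e

@[fun_prop]
theorem continuous_affineFn (n : V3) (e : ℝ) : Continuous (affineFn n e) := by
  unfold affineFn
  fun_prop

theorem affineFn_add_smul_sub (n : V3) (e : ℝ) (x p q : V3) (s : ℝ) :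
    affineFn n e (x + s • (q - p)) =
      affineFn n e x + s * (affineFn n e q - affineFn n e p) := by
  simp only [affineFn, Pi.add_apply, Pi.smul_apply, Pi.sub_apply, smul_eq_mul]
  ring

/-- A vertex `v` can be moved to any point `v'` on its side of a plane containing the remaining
vertices. -/
theorem ambientIsotopic_move_vertex_affine (n : V3) (e : ℝ) {t u v w : V3} (v' : V3)
    (ht : affineFn n e t = 0) (hu : affineFn n e u = 0) (hw : affineFn n e w = 0)
    (hv : affineFn n e v = 1) (hv' : 0 < affineFn n e v') :
    AmbientIsotopic (segment ℝ w t ∪ segment ℝ t u ∪ (segment ℝ u v ∪ segment ℝ v w))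
      (segment ℝ w t ∪ segment ℝ t u ∪ (segment ℝ u v' ∪ segment ℝ v' w)) := by
  refine ambientIsotopic_move_vertex (f := affineFn n e) (by fun_prop) v'
    (c := 1 - affineFn n e v') (by linarith) ?_ ?_ ?_ ?_
  · intro x s _
    rw [affineFn_add_smul_sub, hv]
    linarith
  · rintro p (hp | hp) <;> rw [segment_eq_image'] at hp <;> obtain ⟨s, _, rfl⟩ := hp <;>
      simp [affineFn_add_smul_sub, ht, hu, hw]
  · intro s _
    simp [affineFn_add_smul_sub, hu, hv]
  · intro s _
    simp [affineFn_add_smul_sub, hw, hv]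

/-- A piecewise linear bump function whose support is a thin neighbourhood of a triangle when
`A` and `B` are nonnegative on two of its sides and `C` is a large multiple of the distance to
its plane. -/
def bump (A B C : V3 → ℝ) (p : V3) : ℝ := max 0 (min (A p) (B p) - |C p|)

theorem bump_eq_zero_of_mem_segment {n₁ n₂ n₃ : V3} {e₁ e₂ e₃ : ℝ} {a b : V3} (l r : ℝ)
    (hl : l ∈ Icc (0 : ℝ) 1) (hr : |r| ≤ 1)
    (ha : l * affineFn n₁ e₁ a + (1 - l) * affineFn n₂ e₂ a ≤ r * affineFn n₃ e₃ a)
    (hb : l * affineFn n₁ e₁ b + (1 - l) * affineFn n₂ e₂ b ≤ r * affineFn n₃ e₃ b) :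
    ∀ p ∈ segment ℝ a b, bump (affineFn n₁ e₁) (affineFn n₂ e₂) (affineFn n₃ e₃) p = 0 := by
  intro p hp
  rw [segment_eq_image'] at hp
  obtain ⟨s, hs, rfl⟩ := hp
  refine max_eq_left (sub_nonpos.2 ?_)
  set p := a + s • (b - a) with hp
  have h1 : l * affineFn n₁ e₁ p + (1 - l) * affineFn n₂ e₂ p ≤ r * affineFn n₃ e₃ p := by
    rw [hp, affineFn_add_smul_sub, affineFn_add_smul_sub, affineFn_add_smul_sub]
    nlinarith [mul_le_mul_of_nonneg_left ha (sub_nonneg.2 hs.2),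
      mul_le_mul_of_nonneg_left hb hs.1]
  have h2 : min (affineFn n₁ e₁ p) (affineFn n₂ e₂ p) ≤
      l * affineFn n₁ e₁ p + (1 - l) * affineFn n₂ e₂ p := by
    nlinarith [mul_le_mul_of_nonneg_left (min_le_left (affineFn n₁ e₁ p) (affineFn n₂ e₂ p)) hl.1,
      mul_le_mul_of_nonneg_left (min_le_right (affineFn n₁ e₁ p) (affineFn n₂ e₂ p))
        (sub_nonneg.2 hl.2)]
  have h3 : r * affineFn n₃ e₃ p ≤ |affineFn n₃ e₃ p| := by
    refine (le_abs_self _).trans ?_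
    rw [abs_mul]
    exact mul_le_of_le_one_left (abs_nonneg _) hr
  linarith

/-- Two sides `u v` and `v w` of a triangle can be replaced by the side `u w`, provided that the
rest `X` of the curve avoids the support of a suitable bump function. -/
theorem ambientIsotopic_remove_vertex (n₁ n₂ n₃ : V3) (e₁ e₂ e₃ : ℝ) {X : Set V3} {u v w : V3}
    (hX : ∀ p ∈ X, bump (affineFn n₁ e₁) (affineFn n₂ e₂) (affineFn n₃ e₃) p = 0)
    (h₁u : affineFn n₁ e₁ u = 0) (h₁v : affineFn n₁ e₁ v = 1) (h₁w : affineFn n₁ e₁ w = 1)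
    (h₂u : affineFn n₂ e₂ u = 1) (h₂v : affineFn n₂ e₂ v = 1) (h₂w : affineFn n₂ e₂ w = 0)
    (h₃u : affineFn n₃ e₃ u = 0) (h₃v : affineFn n₃ e₃ v = 0) (h₃w : affineFn n₃ e₃ w = 0) :
    AmbientIsotopic (X ∪ (segment ℝ u v ∪ segment ℝ v w)) (X ∪ segment ℝ u w) := by
  have hmid (n : V3) (e : ℝ) : affineFn n e (midpoint ℝ u w) =
      (affineFn n e u + affineFn n e w) / 2 := by
    rw [midpoint_eq_smul_add]
    simp only [affineFn, Pi.add_apply, Pi.smul_apply, smul_eq_mul, invOf_eq_inv]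
    ring
  have hseg : segment ℝ u w =
      segment ℝ u (midpoint ℝ u w) ∪ segment ℝ (midpoint ℝ u w) w := by
    refine subset_antisymm ?_ (union_subset
      ((convex_segment u w).segment_subset (left_mem_segment ℝ u w) (midpoint_mem_segment u w))
      ((convex_segment u w).segment_subset (midpoint_mem_segment u w) (right_mem_segment ℝ u w)))
    rintro _ ⟨a, b, ha, hb, hab, rfl⟩
    rw [midpoint_eq_smul_add, invOf_eq_inv]
    obtain rfl : a = 1 - b := by linarith
    rcases le_total b (1 / 2) with h | h
    · exact .inl ⟨1 - 2 * b, 2 * b, by linarith, by linarith, by ring, by module⟩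
    · exact .inr ⟨2 - 2 * b, 2 * b - 1, by linarith, by linarith, by ring, by module⟩
  rw [hseg]
  refine ambientIsotopic_move_vertex
    (f := bump (affineFn n₁ e₁) (affineFn n₂ e₂) (affineFn n₃ e₃)) (by unfold bump; fun_prop)
    _ (c := 1 / 2) (by norm_num) ?_ hX ?_ ?_
  · intro x s hs
    simp only [bump, affineFn_add_smul_sub, hmid, h₁u, h₁v, h₁w, h₂u, h₂v, h₂w, h₃u, h₃v, h₃w]
    grind
  · intro s hs
    simp only [bump, affineFn_add_smul_sub, h₁u, h₁v, h₂u, h₂v, h₃u, h₃v]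
    have := hs.1
    have := hs.2
    simp [*]
  · intro s hs
    simp only [bump, affineFn_add_smul_sub, h₁w, h₁v, h₂w, h₂v, h₃w, h₃v]
    have := hs.1
    have := hs.2
    simp [*]

theorem image_plPath (P : ℕ → V3) {m : ℕ} (hm : 0 < m) :
    plPath P m '' Icc 0 1 = ⋃ i < m, segment ℝ (P i) (P (i + 1)) := by
  have hm' : (0 : ℝ) < m := by exact_mod_cast hm
  ext p
  simp only [mem_iUnion, exists_prop]
  constructor
  · rintro ⟨t, ⟨h0, h1⟩, rfl⟩
    rcases h1.eq_or_lt with rfl | h1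
    · refine ⟨m - 1, by omega, ?_⟩
      have : plPath P m 1 = P m := by simp [plPath]
      rw [this, Nat.sub_add_cancel hm]
      exact right_mem_segment ℝ _ _
    · have hs : 0 ≤ t * m := by positivity
      have hfl : ((⌊t * m⌋.toNat : ℕ) : ℝ) = ⌊t * m⌋ := by
        exact_mod_cast Int.toNat_of_nonneg (Int.floor_nonneg.2 hs)
      refine ⟨⌊t * m⌋.toNat, ?_, 1 - (t * m - (⌊t * m⌋.toNat : ℕ)), t * m - (⌊t * m⌋.toNat : ℕ),
        ?_, ?_, by ring, rfl⟩
      · have : ((⌊t * m⌋.toNat : ℕ) : ℝ) < m := by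
          rw [hfl]
          exact (Int.floor_le _).trans_lt (by nlinarith)
        exact_mod_cast this
      · rw [hfl]; linarith [Int.lt_floor_add_one (t * m)]
      · rw [hfl]; linarith [Int.floor_le (t * m)]
  · rintro ⟨i, hi, a, b, ha, hb, hab, rfl⟩
    have hi' : (i : ℝ) + 1 ≤ m := by exact_mod_cast hi
    refine ⟨(i + b) / m, ⟨by positivity, by rw [div_le_one hm']; linarith⟩, ?_⟩
    simp only [plPath, div_mul_cancel₀ _ hm'.ne']
    obtain rfl : a = 1 - b := by linarith
    rcases (show b ≤ 1 by linarith).eq_or_lt with rfl | hb1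
    · have : ⌊(i : ℝ) + 1⌋.toNat = i + 1 := by
        have : ⌊(i : ℝ) + 1⌋ = (i + 1 : ℕ) := by simp
        rw [this, Int.toNat_natCast]
      rw [this]
      simp
    · have : ⌊(i : ℝ) + b⌋.toNat = i := by
        have : ⌊(i : ℝ) + b⌋ = (i : ℤ) := by
          rw [Int.floor_eq_iff]
          constructor <;> push_cast <;> linarith
        rw [this, Int.toNat_natCast]
      rw [this]
      simp

theorem K0_eq_union_segments : K0 =
    segment ℝ (pt 0 9 20) (pt (-15) (-95) (-50)) ∪
    segment ℝ (pt (-15) (-95) (-50)) (pt 40 80 (-20)) ∪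
    segment ℝ (pt 40 80 (-20)) (pt (-10) (-60) 58) ∪
    segment ℝ (pt (-10) (-60) 58) (pt (-60) 30 20) ∪
    segment ℝ (pt (-60) 30 20) (pt 40 (-60) (-60)) ∪
    segment ℝ (pt 40 (-60) (-60)) (pt 0 9 20) := by
  rw [K0, K0loop, image_plPath _ (by norm_num)]
  simp only [Set.biUnion_lt_succ, vertsOf, K0verts]
  simp

theorem K0_isotopic_pentagon : AmbientIsotopic K0
    (segment ℝ (pt 0 9 20) (pt (-15) (-95) (-50)) ∪
    segment ℝ (pt (-15) (-95) (-50)) (pt 40 80 (-20)) ∪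
    segment ℝ (pt (-60) 30 20) (pt 40 (-60) (-60)) ∪
    segment ℝ (pt 40 (-60) (-60)) (pt 0 9 20) ∪
    segment ℝ (pt 40 80 (-20)) (pt (-60) 30 20)) := by
  convert ambientIsotopic_remove_vertex (pt 0 (19/850) (9/170)) (pt 0 (-39/850) (-7/85))
    (pt (-17/100) (-29/50) (-23/20)) (-62/85) (257/85) (151/5)
    (X := segment ℝ (pt 0 9 20) (pt (-15) (-95) (-50)) ∪
      segment ℝ (pt (-15) (-95) (-50)) (pt 40 80 (-20)) ∪
      segment ℝ (pt (-60) 30 20) (pt 40 (-60) (-60)) ∪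
      segment ℝ (pt 40 (-60) (-60)) (pt 0 9 20))
    (u := pt 40 80 (-20)) (v := pt (-10) (-60) 58) (w := pt (-60) 30 20)
    ?_ ?_ ?_ ?_ ?_ ?_ ?_ ?_ ?_ ?_ using 1
  · rw [K0_eq_union_segments]
    ext
    simp only [mem_union]
    tauto
  · rintro p (((hp | hp) | hp) | hp)
    · exact bump_eq_zero_of_mem_segment 0 1 (by norm_num) (by norm_num)
        (by norm_num [affineFn]) (by norm_num [affineFn]) p hp
    · exact bump_eq_zero_of_mem_segment 1 0 (by norm_num) (by norm_num)
        (by norm_num [affineFn]) (by norm_num [affineFn]) p hp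
    · exact bump_eq_zero_of_mem_segment 0 1 (by norm_num) (by norm_num)
        (by norm_num [affineFn]) (by norm_num [affineFn]) p hp
    · exact bump_eq_zero_of_mem_segment 0 1 (by norm_num) (by norm_num)
        (by norm_num [affineFn]) (by norm_num [affineFn]) p hp
  all_goals norm_num [affineFn]

/-- The closed quadrilateral with the given vertices. -/
def quadrilateral (a b c d : V3) : Set V3 :=
  segment ℝ a b ∪ segment ℝ b c ∪ (segment ℝ c d ∪ segment ℝ d a)

theorem quadrilateral_rotate (a b c d : V3) : quadrilateral a b c d = quadrilateral b c d a := by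
  ext
  simp only [quadrilateral, mem_union]
  tauto

theorem pentagon_isotopic_quadrilateral : AmbientIsotopic
    (segment ℝ (pt 0 9 20) (pt (-15) (-95) (-50)) ∪
    segment ℝ (pt (-15) (-95) (-50)) (pt 40 80 (-20)) ∪
    segment ℝ (pt (-60) 30 20) (pt 40 (-60) (-60)) ∪
    segment ℝ (pt 40 (-60) (-60)) (pt 0 9 20) ∪
    segment ℝ (pt 40 80 (-20)) (pt (-60) 30 20))
    (quadrilateral (pt (-15) (-95) (-50)) (pt 40 80 (-20)) (pt (-60) 30 20)
      (pt 40 (-60) (-60))) := by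
  convert ambientIsotopic_remove_vertex (pt 0 (-7/349) (52/1745)) (pt 0 (8/349) (-69/3490))
    (pt (349/1000) (-2/5) (1039/2000)) (204/349) (415/349) (-679/100)
    (X := segment ℝ (pt (-15) (-95) (-50)) (pt 40 80 (-20)) ∪
      segment ℝ (pt 40 80 (-20)) (pt (-60) 30 20) ∪
      segment ℝ (pt (-60) 30 20) (pt 40 (-60) (-60)))
    (u := pt 40 (-60) (-60)) (v := pt 0 9 20) (w := pt (-15) (-95) (-50))
    ?_ ?_ ?_ ?_ ?_ ?_ ?_ ?_ ?_ ?_ using 1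
  · ext
    simp only [mem_union]
    tauto
  · ext
    simp only [quadrilateral, mem_union]
    tauto
  · rintro p ((hp | hp) | hp)
    · exact bump_eq_zero_of_mem_segment 0 (-1) (by norm_num) (by norm_num)
        (by norm_num [affineFn]) (by norm_num [affineFn]) p hp
    · exact bump_eq_zero_of_mem_segment 0 (-1) (by norm_num) (by norm_num)
        (by norm_num [affineFn]) (by norm_num [affineFn]) p hp
    · exact bump_eq_zero_of_mem_segment 1 (-1) (by norm_num) (by norm_num)
        (by norm_num [affineFn]) (by norm_num [affineFn]) p hp
  all_goals norm_num [affineFn]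

/-- Moving the last vertex of a quadrilateral. -/
theorem quadrilateral_isotopic_move (n : V3) (e : ℝ) {a b c d : V3} (d' : V3)
    (ha : affineFn n e a = 0) (hb : affineFn n e b = 0) (hc : affineFn n e c = 0)
    (hd : affineFn n e d = 1) (hd' : 0 < affineFn n e d') :
    AmbientIsotopic (quadrilateral a b c d) (quadrilateral a b c d') :=
  ambientIsotopic_move_vertex_affine n e d' hb hc ha hd hd'

theorem quadrilateral_isotopic_standard : AmbientIsotopic
    (quadrilateral (pt (-15) (-95) (-50)) (pt 40 80 (-20)) (pt (-60) 30 20) (pt 40 (-60) (-60)))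
    (quadrilateral (pt 0 1 (-1)) (pt 1 (-1) 0) (pt 0 1 1) (pt (-1) (-1) 0)) := by
  have h₁ : AmbientIsotopic
      (quadrilateral (pt 40 (-60) (-60)) (pt (-15) (-95) (-50)) (pt 40 80 (-20)) (pt (-60) 30 20))
      (quadrilateral (pt 40 (-60) (-60)) (pt (-15) (-95) (-50)) (pt 40 80 (-20)) (pt 0 1 1)) := by
    apply quadrilateral_isotopic_move (pt (7/345) (-11/690) (77/1380)) (109/69) <;>
      norm_num [affineFn]
  have h₂ : AmbientIsotopic
      (quadrilateral (pt 40 80 (-20)) (pt 0 1 1) (pt 40 (-60) (-60)) (pt (-15) (-95) (-50)))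
      (quadrilateral (pt 40 80 (-20)) (pt 0 1 1) (pt 40 (-60) (-60)) (pt 0 1 (-1))) := by
    apply quadrilateral_isotopic_move (pt (-61/2235) (16/2235) (-56/2235)) (8/447) <;>
      norm_num [affineFn]
  have h₃ : AmbientIsotopic
      (quadrilateral (pt 0 1 (-1)) (pt 40 80 (-20)) (pt 0 1 1) (pt 40 (-60) (-60)))
      (quadrilateral (pt 0 1 (-1)) (pt 40 80 (-20)) (pt 0 1 1) (pt (-1) (-1) 0)) := by
    apply quadrilateral_isotopic_move (pt (79/5600) (-1/140) 0) (1/140) <;>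
      norm_num [affineFn]
  have h₄ : AmbientIsotopic
      (quadrilateral (pt 0 1 1) (pt (-1) (-1) 0) (pt 0 1 (-1)) (pt 40 80 (-20)))
      (quadrilateral (pt 0 1 1) (pt (-1) (-1) 0) (pt 0 1 (-1)) (pt 1 (-1) 0)) := by
    apply quadrilateral_isotopic_move (pt 2 (-1) 0) 1 <;> norm_num [affineFn]
  rw [quadrilateral_rotate _ _ _ (pt (-60) 30 20)] at h₁
  rw [quadrilateral_rotate _ _ _ (pt (-15) (-95) (-50)),
    quadrilateral_rotate _ _ _ (pt 40 80 (-20))] at h₂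
  rw [quadrilateral_rotate _ _ _ (pt 40 (-60) (-60))] at h₃
  rw [quadrilateral_rotate _ _ _ (pt 40 80 (-20)), quadrilateral_rotate _ _ _ (pt 0 1 1),
    quadrilateral_rotate _ _ _ (pt 1 (-1) 0), quadrilateral_rotate _ _ _ (pt 0 1 1)] at h₄
  exact h₁.trans (h₂.trans (h₃.trans h₄))

theorem quadrilateral_standard_eq :
    quadrilateral (pt 0 1 (-1)) (pt 1 (-1) 0) (pt 0 1 1) (pt (-1) (-1) 0) =
      {p | |p 0| + |p 2| = 1 ∧ p 1 = 2 * |p 2| - 1} := by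
  ext p
  constructor
  · rintro ((h | h) | (h | h)) <;> obtain ⟨a, b, ha, hb, hab, rfl⟩ := h <;>
      simp [abs_of_nonneg ha, abs_of_nonneg hb] <;> constructor <;> linarith
  · rintro ⟨h₁, h₂⟩
    have hp (q : V3) (h0 : q 0 = p 0) (h1 : q 1 = p 1) (h2 : q 2 = p 2) : q = p := by
      ext i
      fin_cases i <;> assumption
    rcases le_total 0 (p 0) with h0 | h0 <;> rcases le_total 0 (p 2) with h2 | h2 <;>
      simp only [abs_of_nonneg, abs_of_nonpos, h0, h2] at h₁ h₂
    · refine .inl (.inr ⟨p 0, p 2, h0, h2, h₁, hp _ ?_ ?_ ?_⟩) <;> simp <;> linarith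
    · refine .inl (.inl ⟨-p 2, p 0, by linarith, h0, by linarith, hp _ ?_ ?_ ?_⟩) <;> simp <;>
        linarith
    · refine .inr (.inl ⟨p 2, -p 0, h2, by linarith, by linarith, hp _ ?_ ?_ ?_⟩) <;> simp <;>
        linarith
    · refine .inr (.inr ⟨-p 0, -p 2, by linarith, by linarith, by linarith, hp _ ?_ ?_ ?_⟩) <;>
        simp <;> linarith

/-- The odd extension of a function from the nonnegative half-line (vanishing at `0`). -/
def oddExtension (g : ℝ → ℝ) (z : ℝ) : ℝ := g (max z 0) - g (max (-z) 0)

@[fun_prop]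
theorem continuous_oddExtension {g : ℝ → ℝ} (hg : Continuous g) :
    Continuous (oddExtension g) := by
  unfold oddExtension
  fun_prop

theorem oddExtension_of_nonneg {g : ℝ → ℝ} (hg : g 0 = 0) {z : ℝ} (hz : 0 ≤ z) :
    oddExtension g z = g z := by
  simp [oddExtension, hz, hg]

theorem oddExtension_of_nonpos {g : ℝ → ℝ} (hg : g 0 = 0) {z : ℝ} (hz : z ≤ 0) :
    oddExtension g z = -g (-z) := by
  simp [oddExtension, hz, hg]

theorem standard_isotopic_unitCircle : AmbientIsotopic
    {p | |p 0| + |p 2| = 1 ∧ p 1 = 2 * |p 2| - 1} unitCircle := by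
  -- lift the height profile of the quadrilateral to that of a circle, then flatten
  let g : ℝ → ℝ := fun r => √(2 * r - r ^ 2)
  let k : ℝ → ℝ := fun r => 1 - √(1 - r ^ 2)
  have hg0 : g 0 = 0 := by simp [g]
  have hk0 : k 0 = 0 := by simp [k]
  have hg : Continuous (oddExtension g) := by fun_prop
  have hk : Continuous (oddExtension k) := by fun_prop
  have h₁ := ambientIsotopic_image_add_smul
    (f := fun p => oddExtension g (p 2) - (2 * |p 2| - 1))
    (by fun_prop) (pt 0 1 0) (c := 0) (by norm_num) (by simp)
    {p | |p 0| + |p 2| = 1 ∧ p 1 = 2 * |p 2| - 1}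
  have h₂ := ambientIsotopic_image_add_smul (f := fun p => -oddExtension k (p 1))
    (by fun_prop) (pt 0 0 1) (c := 0) (by norm_num) (by simp)
    ((fun p : V3 => p + (oddExtension g (p 2) - (2 * |p 2| - 1)) • pt 0 1 0) ''
      {p : V3 | |p 0| + |p 2| = 1 ∧ p 1 = 2 * |p 2| - 1})
  have hkg (r : ℝ) (h0 : 0 ≤ r) (h1 : r ≤ 1) : k (g r) = r := by
    simp only [k, g]
    rw [Real.sq_sqrt (by nlinarith), show 1 - (2 * r - r ^ 2) = (1 - r) ^ 2 by ring,
      Real.sqrt_sq (by linarith)]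
    ring
  have hgk (r : ℝ) (h0 : 0 ≤ r) (h1 : r ≤ 1) : g (k r) = r := by
    have h := Real.sq_sqrt (show 0 ≤ 1 - r ^ 2 by nlinarith)
    simp only [k, g]
    rw [show 2 * (1 - √(1 - r ^ 2)) - (1 - √(1 - r ^ 2)) ^ 2 = r ^ 2 by linarith,
      Real.sqrt_sq h0]
  have hg_nonneg (r : ℝ) : 0 ≤ g r := Real.sqrt_nonneg _
  have hk_nonneg (r : ℝ) : 0 ≤ k r := by
    have : √(1 - r ^ 2) ≤ 1 := Real.sqrt_le_one.2 (by nlinarith [sq_nonneg r])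
    simp only [k]
    linarith
  have hkg' (z : ℝ) (hz : |z| ≤ 1) : oddExtension k (oddExtension g z) = z := by
    rw [abs_le] at hz
    rcases le_total 0 z with h | h
    · rw [oddExtension_of_nonneg hg0 h, oddExtension_of_nonneg hk0 (hg_nonneg _),
        hkg z h hz.2]
    · rw [oddExtension_of_nonpos hg0 h, oddExtension_of_nonpos hk0 (neg_nonpos.2 (hg_nonneg _)),
        neg_neg, hkg (-z) (by linarith) (by linarith), neg_neg]
  have hgk' (z : ℝ) (hz : |z| ≤ 1) : oddExtension g (oddExtension k z) = z := by
    rw [abs_le] at hz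
    rcases le_total 0 z with h | h
    · rw [oddExtension_of_nonneg hk0 h, oddExtension_of_nonneg hg0 (hk_nonneg _),
        hgk z h hz.2]
    · rw [oddExtension_of_nonpos hk0 h, oddExtension_of_nonpos hg0 (neg_nonpos.2 (hk_nonneg _)),
        neg_neg, hgk (-z) (by linarith) (by linarith), neg_neg]
  have hg_sq (z : ℝ) (hz : |z| ≤ 1) : oddExtension g z ^ 2 = 1 - (1 - |z|) ^ 2 := by
    have h : g |z| ^ 2 = 1 - (1 - |z|) ^ 2 := by
      simp only [g]
      rw [Real.sq_sqrt (by nlinarith [abs_nonneg z])]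
      ring
    rw [← h]
    rcases le_total 0 z with h | h
    · rw [oddExtension_of_nonneg hg0 h, abs_of_nonneg h]
    · rw [oddExtension_of_nonpos hg0 h, abs_of_nonpos h, neg_sq]
  have hk_abs (y : ℝ) : |oddExtension k y| = 1 - √(1 - y ^ 2) := by
    rcases le_total 0 y with h | h
    · rw [oddExtension_of_nonneg hk0 h, abs_of_nonneg (hk_nonneg _)]
    · rw [oddExtension_of_nonpos hk0 h, abs_neg, abs_of_nonneg (hk_nonneg _)]
      simp only [k, neg_sq]
  convert h₁.trans h₂ using 1
  rw [image_image]
  ext p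
  constructor
  · rintro ⟨x, y, hxy, rfl⟩
    have hy : |y| ≤ 1 := abs_le_one_iff_mul_self_le_one.2 (by nlinarith)
    have hx : √(1 - y ^ 2) = |x| := by
      rw [← Real.sqrt_sq_eq_abs]
      congr 1
      linarith
    refine ⟨pt x (2 * |oddExtension k y| - 1) (oddExtension k y), ⟨?_, by simp⟩, ?_⟩
    · simp [hk_abs, hx]
    · ext i
      fin_cases i <;> simp [hgk' y hy]
  · rintro ⟨q, ⟨hq, hq1⟩, rfl⟩
    have hq2 : |q 2| ≤ 1 := by linarith [abs_nonneg (q 0)]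
    refine ⟨q 0, oddExtension g (q 2), ?_, ?_⟩
    · rw [hg_sq _ hq2, ← hq, ← sq_abs (q 0)]
      ring
    · ext i
      fin_cases i <;> simp [hq1, hkg' _ hq2]

/-- K₀ is the unknot: there is an ambient isotopy between K₀ and
the round circle {(x,y,0) : x² + y² = 1}. -/
theorem K0_is_unknot : AmbientIsotopic K0 unitCircle := by
  exact K0_isotopic_pentagon.trans (pentagon_isotopic_quadrilateral.trans
    (quadrilateral_isotopic_standard.trans
      (quadrilateral_standard_eq ▸ standard_isotopic_unitCircle)))
end
end

section
/- The curve K_{0,4}, obtained from K_0 by 4 iterations of de Casteljau subdivision at parameter 1/2, is the unknot: there is an ambient isotopy between K_{0,4} and the round circle {(x,y,0) : x² + y² = 1}. -/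
open Set Real

noncomputable section

/-- Coordinates on `ℝ³` with horizontal part `x + z i` and height `y`. -/
def coords : V3 ≃ₜ ℂ × ℝ where
  toFun p := (p 0 + p 2 * Complex.I, p 1)
  invFun q := ![q.1.re, q.2, q.1.im]
  left_inv p := by ext i; fin_cases i <;> simp
  right_inv q := by ext <;> simp
  continuous_toFun := by fun_prop
  continuous_invFun := by
    refine continuous_pi fun i => ?_
    fin_cases i
    · exact Complex.continuous_re.comp continuous_fst
    · exact continuous_snd
    · exact Complex.continuous_im.comp continuous_fst

/-- The shear translating each horizontal plane. -/
def shearFst (g : ℝ → ℂ) (hg : Continuous g) : ℂ × ℝ ≃ₜ ℂ × ℝ where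
  toFun q := (q.1 + g q.2, q.2)
  invFun q := (q.1 - g q.2, q.2)
  left_inv q := by simp
  right_inv q := by simp
  continuous_toFun := by fun_prop
  continuous_invFun := by fun_prop

/-- The shear translating each vertical line. -/
def shearSnd (F : ℂ → ℝ) (hF : Continuous F) : ℂ × ℝ ≃ₜ ℂ × ℝ where
  toFun q := (q.1, q.2 + F q.1)
  invFun q := (q.1, q.2 - F q.1)
  left_inv q := by simp
  right_inv q := by simp
  continuous_toFun := by fun_prop
  continuous_invFun := by fun_prop

/-- The homeomorphism rotating and rescaling each horizontal plane. -/
def twist (κ : ℝ → ℂ) (hκ : Continuous κ) (h0 : ∀ y, κ y ≠ 0) : ℂ × ℝ ≃ₜ ℂ × ℝ where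
  toFun q := (q.1 * κ q.2, q.2)
  invFun q := (q.1 / κ q.2, q.2)
  left_inv q := by simp [h0]
  right_inv q := by simp [h0]
  continuous_toFun := by fun_prop
  continuous_invFun := by fun_prop (disch := simp [h0])

/-- Two shears of the horizontal planes, with a vertical shear in between, followed by a twist
form the end of an ambient isotopy. -/
theorem ambientIsotopic_of_shears {X Y : Set V3} {g m κ : ℝ → ℂ} {F : ℂ → ℝ}
    (hg : Continuous g) (hm : Continuous m) (hF : Continuous F) (hκ : Continuous κ)
    (h0 : ∀ y, κ y ≠ 0)
    (hXY : (fun x => coords.symm (twist κ hκ h0 (shearFst m hm (shearSnd F hF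
      (shearFst g hg (coords x)))))) '' X = Y) :
    AmbientIsotopic X Y := by
  let E : ℝ → ℝ → ℂ := fun t y => κ (t * y) / κ 0 * Complex.exp (t * Complex.log (κ 0))
  have hE : Continuous fun q : ℝ × ℝ => E q.1 q.2 := by
    unfold E; fun_prop
  have hE0 : ∀ t y, E t y ≠ 0 := fun t y => by simp [E, h0]
  have hEt : ∀ t, Continuous (E t) := fun t => by fun_prop
  let Φ : ℝ → V3 ≃ₜ V3 := fun t => (((coords.trans (shearFst (t • g) (hg.const_smul t))).trans
    (shearSnd (t • F) (hF.const_smul t))).trans (shearFst (t • m) (hm.const_smul t))).trans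
    ((twist (E t) (hEt t) (hE0 t)).trans coords.symm)
  refine ⟨fun x t => Φ t x, Continuous.continuousOn ?_, fun x => ?_,
    fun t _ => ⟨Φ t, fun _ => rfl⟩, ?_⟩
  · have hc : Continuous fun p : V3 × ℝ => coords p.1 := coords.continuous.comp continuous_fst
    refine coords.symm.continuous.comp (g := coords.symm) ?_
    have h1 : Continuous fun p : V3 × ℝ => (coords p.1).1 + (p.2 • g) (coords p.1).2 := by
      simp only [Pi.smul_apply]; fun_prop
    have h2 : Continuous fun p : V3 × ℝ => (coords p.1).2 +
        (p.2 • F) ((coords p.1).1 + (p.2 • g) (coords p.1).2) := by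
      simp only [Pi.smul_apply] at h1 ⊢; fun_prop
    refine Continuous.prodMk (Continuous.mul (h1.add ?_) ?_) h2
    · exact continuous_snd.smul (hm.comp h2)
    · exact hE.comp (continuous_snd.prodMk h2)
  · simp [Φ, E, shearFst, shearSnd, twist, h0]
  · rw [← hXY]
    refine image_congr fun x _ => ?_
    simp [Φ, E, shearFst, shearSnd, twist, h0, Complex.exp_log]

/-- A continuous function on a simple closed planar curve extends to the plane. -/
theorem exists_continuous_extension_of_loop {p : ℝ → ℂ} {G : ℝ → ℝ}
    (hp : ContinuousOn p (Icc 0 1)) (hp01 : p 0 = p 1) (hinj : InjOn p (Ico 0 1))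
    (hG : ContinuousOn G (Icc 0 1)) (hG01 : G 0 = G 1) :
    ∃ F : ℂ → ℝ, Continuous F ∧ ∀ t ∈ Icc (0 : ℝ) 1, F (p t) = G t := by
  have : Fact ((0 : ℝ) < 1) := ⟨one_pos⟩
  have hp' : Continuous (AddCircle.liftIco (1 : ℝ) 0 p) :=
    AddCircle.liftIco_continuous (by simpa using hp01) (by simpa using hp)
  have hG' : Continuous (AddCircle.liftIco (1 : ℝ) 0 G) :=
    AddCircle.liftIco_continuous (by simpa using hG01) (by simpa using hG)
  have hval : ∀ (f : ℝ → ℂ) (t : ℝ), t ∈ Ico (0 : ℝ) 1 →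
      AddCircle.liftIco (1 : ℝ) 0 f (t : AddCircle (1 : ℝ)) = f t := fun f t ht =>
    AddCircle.liftIco_coe_apply (by simpa using ht)
  have hvalG : ∀ t ∈ Ico (0 : ℝ) 1,
      AddCircle.liftIco (1 : ℝ) 0 G (t : AddCircle (1 : ℝ)) = G t := fun t ht =>
    AddCircle.liftIco_coe_apply (by simpa using ht)
  have hrep : ∀ a : AddCircle (1 : ℝ), ∃ t ∈ Ico (0 : ℝ) 1, (t : AddCircle (1 : ℝ)) = a := by
    intro a
    have := (AddCircle.equivIco (1 : ℝ) 0 a).2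
    exact ⟨_, by simpa using this, (AddCircle.equivIco (1 : ℝ) 0).symm_apply_apply a⟩
  have hemb : Topology.IsClosedEmbedding (AddCircle.liftIco (1 : ℝ) 0 p) := by
    refine hp'.isClosedEmbedding fun a b hab => ?_
    obtain ⟨s, hs, rfl⟩ := hrep a
    obtain ⟨t, ht, rfl⟩ := hrep b
    rw [hval p s hs, hval p t ht] at hab
    rw [hinj hs ht hab]
  obtain ⟨F, hF⟩ := ContinuousMap.exists_extension hemb ⟨_, hG'⟩
  have hF' : ∀ t ∈ Ico (0 : ℝ) 1, F (p t) = G t := fun t ht => by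
    have := DFunLike.congr_fun hF (t : AddCircle (1 : ℝ))
    simpa [hval p t ht, hvalG t ht] using this
  refine ⟨F, F.continuous, fun t ht => ?_⟩
  rcases ht.2.eq_or_lt with rfl | h
  · rw [← hp01, ← hG01]; exact hF' 0 (by simp)
  · exact hF' t ⟨ht.1, h⟩

/-- The parameter in `[-1, 1]` of the points at height `y` on the unit circle, rationally
parameterized by `u ↦ (±(1 - u²) / (1 + u²), 2 * u / (1 + u²))`. -/
def heightParam (y : ℝ) : ℝ := projIcc (-1 : ℝ) 1 (by norm_num) (y / (1 + √(1 - y ^ 2)))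

theorem continuous_heightParam : Continuous heightParam := by
  refine continuous_subtype_val.comp (continuous_projIcc.comp ?_)
  refine continuous_id.div (by fun_prop) fun y => ?_
  positivity

theorem heightParam_mem (y : ℝ) : heightParam y ∈ Icc (-1 : ℝ) 1 := Subtype.coe_prop _

theorem heightParam_apply {u : ℝ} (hu : u ∈ Icc (-1 : ℝ) 1) :
    heightParam (2 * u / (1 + u ^ 2)) = u := by
  have hpos : 0 < 1 + u ^ 2 := by positivity
  have h1 : 0 ≤ 1 - u ^ 2 := by nlinarith [hu.1, hu.2]
  have hsq : √(1 - (2 * u / (1 + u ^ 2)) ^ 2) = (1 - u ^ 2) / (1 + u ^ 2) := by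
    rw [← Real.sqrt_sq (div_nonneg h1 hpos.le)]
    congr 1
    field_simp
    ring
  have : 2 * u / (1 + u ^ 2) / (1 + √(1 - (2 * u / (1 + u ^ 2)) ^ 2)) = u := by
    rw [hsq]
    field_simp
    ring
  rw [heightParam, this, projIcc_of_mem _ hu]

/-- A loop with a simple planar projection, whose two arcs between the parameters `0` and `1/2`
separate linearly at both ends, is unknotted. -/
theorem ambientIsotopic_unitCircle_of_loop {γ : ℝ → V3} {c : ℂ} {e : ℝ → ℂ}
    (hγ : ContinuousOn γ (Icc 0 1)) (hγ01 : γ 0 = γ 1)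
    {p : ℝ → ℂ} (hp : ∀ t, p t = (coords (γ t)).1 + γ t 1 * c)
    (hinj : InjOn p (Ico 0 1))
    (he : ContinuousOn e (Icc (-1) 1)) (he0 : ∀ u ∈ Icc (-1 : ℝ) 1, e u ≠ 0)
    (hpe : ∀ u ∈ Icc (-1 : ℝ) 1,
      p ((1 + u) / 4) - p (1 - (1 + u) / 4) = ((1 - u ^ 2 : ℝ) : ℂ) * e u) :
    AmbientIsotopic (γ '' Icc 0 1) unitCircle := by
  have hγ1 : ContinuousOn (fun t => γ t 1) (Icc 0 1) := (continuous_apply 1).comp_continuousOn hγ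
  have hpc : ContinuousOn p (Icc 0 1) := by
    rw [funext hp]
    exact (continuous_fst.comp_continuousOn (coords.continuous.comp_continuousOn hγ)).add
      ((Complex.continuous_ofReal.comp_continuousOn hγ1).mul continuousOn_const)
  have hpos : ∀ u : ℝ, 1 + u ^ 2 ≠ 0 := fun u => by positivity
  let y : ℝ → ℝ := fun u => 2 * u / (1 + u ^ 2)
  have hy : Continuous y := by unfold y; fun_prop (disch := simpa using hpos)
  let τ : ℝ → ℝ := fun t => 1 - 4 * |t - 1 / 2|
  obtain ⟨F, hF, hFp⟩ := exists_continuous_extension_of_loop (p := p)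
    (G := fun t => y (τ t) - γ t 1) hpc (by rw [hp, hp, hγ01]) hinj
    (((hy.comp (by fun_prop : Continuous τ)).continuousOn).sub hγ1)
    (by simp only [τ, hγ01]; norm_num)
  let s : ℝ → ℝ := fun y => (1 + heightParam y) / 4
  have hsc : Continuous s := by
    have := continuous_heightParam
    fun_prop
  have hsm : ∀ y, s y ∈ Icc (0 : ℝ) 1 := fun y => by
    have := heightParam_mem y
    constructor <;> simp only [s] <;> linarith [this.1, this.2]
  have hsm' : ∀ y, 1 - s y ∈ Icc (0 : ℝ) 1 := fun y =>
    ⟨by linarith [(hsm y).2], by linarith [(hsm y).1]⟩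
  let m : ℝ → ℂ := fun y => -((p (s y) + p (1 - s y)) / 2)
  have hm : Continuous m := by
    have h1 := hpc.comp_continuous hsc hsm
    have h2 := hpc.comp_continuous (continuous_const.sub hsc) hsm'
    exact ((h1.add h2).div_const 2).neg
  let κ : ℝ → ℂ := fun y => 2 / ((1 + heightParam y ^ 2 : ℝ) * e (heightParam y))
  have hden : ∀ y, ((1 + heightParam y ^ 2 : ℝ) : ℂ) * e (heightParam y) ≠ 0 := fun y =>
    mul_ne_zero (by exact_mod_cast hpos _) (he0 _ (heightParam_mem y))
  have hκ : Continuous κ := by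
    refine continuous_const.div ?_ hden
    exact (Complex.continuous_ofReal.comp (by have := continuous_heightParam; fun_prop)).mul
      (he.comp_continuous continuous_heightParam heightParam_mem)
  have hκ0 : ∀ y, κ y ≠ 0 := fun y => div_ne_zero two_ne_zero (hden y)
  refine ambientIsotopic_of_shears (g := fun y => y * c) (by fun_prop) hm hF hκ hκ0 ?_
  rw [image_image]
  have hτ : ∀ t ∈ Icc (0 : ℝ) 1, τ t ∈ Icc (-1 : ℝ) 1 := fun t ht => by
    have : |t - 1 / 2| ≤ 1 / 2 := abs_le.2 ⟨by linarith [ht.1], by linarith [ht.2]⟩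
    have := abs_nonneg (t - 1 / 2)
    constructor <;> simp only [τ] <;> linarith
  have key : ∀ t ∈ Icc (0 : ℝ) 1, coords.symm (twist κ hκ hκ0 (shearFst m hm (shearSnd F hF
      (shearFst (fun y => y * c) (by fun_prop) (coords (γ t)))))) =
      pt ((if t ≤ 1 / 2 then 1 else -1) * ((1 - τ t ^ 2) / (1 + τ t ^ 2))) (y (τ t)) 0 := by
    intro t ht
    have hcoords : (coords (γ t)).2 = γ t 1 := rfl
    have hu := hτ t ht
    have hd := hpe _ hu
    have hhp : heightParam (y (τ t)) = τ t := heightParam_apply hu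
    have hC : ((1 + τ t ^ 2 : ℝ) : ℂ) ≠ 0 := by exact_mod_cast hpos _
    have he' := he0 _ hu
    have hsplit : p t + m (y (τ t)) =
        (if t ≤ 1 / 2 then 1 else -1 : ℝ) * ((1 - τ t ^ 2 : ℝ) * e (τ t) / 2) := by
      rw [← hd]
      simp only [m, s, hhp]
      split_ifs with h
      · have : (1 + τ t) / 4 = t := by
          simp only [τ, abs_of_nonpos (by linarith : t - 1 / 2 ≤ 0)]; ring
        rw [this]; push_cast; ring
      · have : 1 - (1 + τ t) / 4 = t := by
          simp only [τ, abs_of_nonneg (by linarith : 0 ≤ t - 1 / 2)]; ring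
        rw [this]; push_cast; ring
    have hfst : (p t + m (y (τ t))) * κ (y (τ t)) =
        (((if t ≤ 1 / 2 then 1 else -1) * ((1 - τ t ^ 2) / (1 + τ t ^ 2)) : ℝ) : ℂ) := by
      rw [hsplit]
      simp only [κ, hhp]
      push_cast at hC ⊢
      field_simp
    rw [Homeomorph.symm_apply_eq]
    have h1 : shearSnd F hF (shearFst (fun y => y * c) (by fun_prop) (coords (γ t))) =
        (p t, y (τ t)) := by
      simp [shearSnd, shearFst, hcoords, ← hp, hFp t ht]
    rw [h1]
    refine Prod.ext (hfst.trans ?_) ?_ <;> simp [coords, pt, shearFst, twist]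
  rw [image_congr key]
  have hcirc : ∀ u : ℝ, ((1 - u ^ 2) / (1 + u ^ 2)) ^ 2 + (y u) ^ 2 = 1 := fun u => by
    have := hpos u
    simp only [y]
    field_simp
    ring
  ext q
  constructor
  · rintro ⟨t, -, rfl⟩
    refine ⟨_, _, ?_, rfl⟩
    refine Eq.trans ?_ (hcirc (τ t))
    split_ifs <;> ring
  · rintro ⟨x, z, hxz, rfl⟩
    have hx : |x| ^ 2 + z ^ 2 = 1 := by rwa [sq_abs]
    have hx0 := abs_nonneg x
    set u := z / (1 + |x|) with hu_def
    have h1x : 1 + |x| ≠ 0 := by positivity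
    have hu2 : u ^ 2 = (1 - |x|) / (1 + |x|) := by
      rw [hu_def, div_pow, div_eq_div_iff (by positivity) h1x]
      linear_combination (1 + |x|) * hx
    have hy' : y u = z := by
      simp only [y, hu2]
      rw [hu_def]
      field_simp
      ring
    have hx' : (1 - u ^ 2) / (1 + u ^ 2) = |x| := by
      rw [hu2]
      field_simp
      ring
    have hu : u ∈ Icc (-1 : ℝ) 1 := by
      rw [mem_Icc, ← abs_le, ← sq_le_one_iff_abs_le_one, hu2, div_le_one (by positivity)]
      linarith
    rcases le_or_gt 0 x with hs | hs
    · have ht : (1 + u) / 4 ≤ 1 / 2 := by linarith [hu.2]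
      have hτu : τ ((1 + u) / 4) = u := by
        simp only [τ, abs_of_nonpos (by linarith : (1 + u) / 4 - 1 / 2 ≤ 0)]; ring
      refine ⟨(1 + u) / 4, ⟨by linarith [hu.1], by linarith⟩, ?_⟩
      simp only [if_pos ht, hτu, hx', hy', one_mul, abs_of_nonneg hs]
    · have hu1 : u < 1 := by
        refine lt_of_le_of_ne hu.2 fun h => ?_
        rw [h] at hx'
        have := abs_pos.2 hs.ne
        norm_num at hx'
        linarith
      have ht : ¬ (1 - (1 + u) / 4 ≤ 1 / 2) := by linarith
      have hτu : τ (1 - (1 + u) / 4) = u := by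
        simp only [τ, abs_of_nonneg (by linarith : 0 ≤ 1 - (1 + u) / 4 - 1 / 2)]; ring
      refine ⟨1 - (1 + u) / 4, ⟨by linarith, by linarith [hu.1]⟩, ?_⟩
      simp only [if_neg ht, hτu, hx', hy', abs_of_neg hs, neg_mul, one_mul, neg_neg]

theorem plPath_of_mem {P : ℕ → V3} {m i : ℕ} {t : ℝ} (h : t * m ∈ Icc (i : ℝ) (i + 1)) :
    plPath P m t = (1 - (t * m - i)) • P i + (t * m - i) • P (i + 1) := by
  rcases h.2.eq_or_lt with h' | h'
  · simp [plPath, h']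
  · have : ⌊t * m⌋ = (i : ℤ) := Int.floor_eq_iff.2 ⟨by exact_mod_cast h.1, by exact_mod_cast h'⟩
    simp [plPath, this]

theorem continuousOn_plPath (P : ℕ → V3) (m : ℕ) : ContinuousOn (plPath P m) (Icc 0 1) := by
  have key : ∀ k : ℕ, ContinuousOn (plPath P m) {t | t * m ∈ Icc (0 : ℝ) k} := by
    intro k
    induction k with
    | zero =>
      refine ContinuousOn.congr (f := fun _ => P 0) continuousOn_const fun t ht => ?_
      have h0 : t * m = 0 := le_antisymm (by simpa using ht.2) ht.1
      simp [plPath, h0]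
    | succ k ih =>
      have hseg : ContinuousOn (plPath P m) {t | t * m ∈ Icc (k : ℝ) (k + 1)} :=
        ContinuousOn.congr (f := fun t : ℝ => (1 - (t * m - k)) • P k + (t * m - k) • P (k + 1))
          (by fun_prop) fun t ht => plPath_of_mem ht
      have hcl : ∀ a b : ℝ, IsClosed {t : ℝ | t * m ∈ Icc a b} := fun a b =>
        isClosed_Icc.preimage (by fun_prop : Continuous fun t : ℝ => t * m)
      refine (ih.union_of_isClosed hseg (hcl _ _) (hcl _ _)).mono fun t ht => ?_
      rcases le_total (t * m) k with h | h
      · exact Or.inl ⟨ht.1, h⟩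
      · exact Or.inr ⟨h, by exact_mod_cast ht.2⟩
  refine (key m).mono fun t ht => ⟨by have := ht.1; positivity, ?_⟩
  exact mul_le_of_le_one_left (Nat.cast_nonneg m) ht.2

/-- A function on `[-1, 1]` which is linear near the endpoints and vanishes exactly there is the
product of `1 - u²` and a nonvanishing continuous function. -/
theorem exists_continuousOn_factor {d : ℝ → ℂ} (hd : ContinuousOn d (Icc (-1) 1))
    (h0 : ∀ u ∈ Ioo (-1 : ℝ) 1, d u ≠ 0) {ε : ℝ} (hε : 0 < ε) {a b : ℂ} (ha : a ≠ 0) (hb : b ≠ 0)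
    (hl : ∀ u ∈ Icc (-1) (-1 + ε), d u = (1 + u : ℝ) • a)
    (hr : ∀ u ∈ Icc (1 - ε) 1, d u = (1 - u : ℝ) • b) :
    ∃ e : ℝ → ℂ, ContinuousOn e (Icc (-1) 1) ∧ (∀ u ∈ Icc (-1 : ℝ) 1, e u ≠ 0) ∧
      ∀ u ∈ Icc (-1 : ℝ) 1, d u = ((1 - u ^ 2 : ℝ) : ℂ) * e u := by
  let e : ℝ → ℂ := fun u =>
    if u ≤ -1 then (1 / 2 : ℝ) • a else if 1 ≤ u then (1 / 2 : ℝ) • b else (1 - u ^ 2)⁻¹ • d u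
  have hsq : ∀ u ∈ Ioo (-1 : ℝ) 1, 1 - u ^ 2 ≠ 0 := fun u hu => by nlinarith [hu.1, hu.2]
  have hmid : ∀ u ∈ Ioo (-1 : ℝ) 1, e u = (1 - u ^ 2)⁻¹ • d u := fun u hu => by
    simp [e, hu.1.not_ge, hu.2.not_ge]
  have hleft : e (-1) = (1 / 2 : ℝ) • a := by simp [e]
  have hright : e 1 = (1 / 2 : ℝ) • b := by norm_num [e]
  refine ⟨e, fun x hx => ?_, fun u hu => ?_, fun u hu => ?_⟩
  · rcases hx.1.eq_or_lt with rfl | h1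
    · have hc : ContinuousWithinAt (fun u : ℝ => (1 - u)⁻¹ • a) (Icc (-1) 1) (-1) :=
        ((continuousAt_const.sub continuousAt_id).inv₀ (by norm_num)).continuousWithinAt.smul
          continuousWithinAt_const
      refine hc.congr_of_eventuallyEq ?_ (by rw [hleft]; norm_num)
      filter_upwards [self_mem_nhdsWithin, mem_nhdsWithin_of_mem_nhds
        (Iio_mem_nhds (by linarith : (-1 : ℝ) < -1 + ε)),
        mem_nhdsWithin_of_mem_nhds (Iio_mem_nhds (by norm_num : (-1 : ℝ) < 1))] with u hu hu' hu1
      rcases hu.1.eq_or_lt with rfl | h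
      · rw [hleft]; norm_num
      · rw [hmid u ⟨h, hu1⟩, hl u ⟨hu.1, hu'.le⟩, smul_smul]
        congr 1
        have := hsq u ⟨h, hu1⟩
        have : 1 - u ≠ 0 := by linarith [mem_Iio.1 hu1]
        field_simp
        ring
    rcases hx.2.eq_or_lt with rfl | h2
    · have hc : ContinuousWithinAt (fun u : ℝ => (1 + u)⁻¹ • b) (Icc (-1) 1) 1 :=
        ((continuousAt_const.add continuousAt_id).inv₀ (by norm_num)).continuousWithinAt.smul
          continuousWithinAt_const
      refine hc.congr_of_eventuallyEq ?_ (by rw [hright]; norm_num)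
      filter_upwards [self_mem_nhdsWithin, mem_nhdsWithin_of_mem_nhds
        (Ioi_mem_nhds (by linarith : (1 : ℝ) - ε < 1)),
        mem_nhdsWithin_of_mem_nhds (Ioi_mem_nhds (by norm_num : (-1 : ℝ) < 1))] with u hu hu' hu1
      rcases hu.2.eq_or_lt with rfl | h
      · rw [hright]; norm_num
      · rw [hmid u ⟨hu1, h⟩, hr u ⟨hu'.le, hu.2⟩, smul_smul]
        congr 1
        have := hsq u ⟨hu1, h⟩
        have : 1 + u ≠ 0 := by linarith [mem_Ioi.1 hu1]
        field_simp
        ring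
    · have hc : ContinuousWithinAt (fun u : ℝ => (1 - u ^ 2)⁻¹ • d u) (Icc (-1) 1) x := by
        have : ContinuousAt (fun u : ℝ => 1 - u ^ 2) x := by fun_prop
        exact (this.inv₀ (hsq x ⟨h1, h2⟩)).continuousWithinAt.smul (hd x hx)
      refine hc.congr_of_eventuallyEq ?_ (hmid x ⟨h1, h2⟩)
      filter_upwards [mem_nhdsWithin_of_mem_nhds (Ioo_mem_nhds h1 h2)] with u hu using hmid u hu
  · rcases hu.1.eq_or_lt with rfl | h1
    · simpa [hleft] using ha
    rcases hu.2.eq_or_lt with rfl | h2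
    · simpa [hright] using hb
    · rw [hmid u ⟨h1, h2⟩]
      exact smul_ne_zero (inv_ne_zero (hsq u ⟨h1, h2⟩)) (h0 u ⟨h1, h2⟩)
  · rcases hu.1.eq_or_lt with rfl | h1
    · simp [hl (-1) ⟨le_rfl, by linarith⟩]
    rcases hu.2.eq_or_lt with rfl | h2
    · simp [hr 1 ⟨by linarith, le_rfl⟩]
    · rw [hmid u ⟨h1, h2⟩, ← Complex.real_smul, smul_inv_smul₀ (hsq u ⟨h1, h2⟩)]

/-- The projection of `ℝ³` to the `xz`-plane along the direction `(-re c, 1, -im c)`. -/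
def obliqueProj (c : ℂ) : V3 →ₗ[ℝ] ℂ where
  toFun v := (coords v).1 + v 1 * c
  map_add' v w := by simp [coords]; ring
  map_smul' r v := by simp [coords]; ring

/-- The oblique projection of `P` is a simple closed polygon with `m` edges. -/
def ProjectsSimply (c : ℂ) (P : ℕ → V3) (m : ℕ) : Prop :=
  ∀ i j, i < j → j < m → ∀ f ∈ Ico (0 : ℝ) 1, ∀ g ∈ Ico (0 : ℝ) 1,
    (1 - f) • obliqueProj c (P i) + f • obliqueProj c (P (i + 1)) ≠
      (1 - g) • obliqueProj c (P j) + g • obliqueProj c (P (j + 1))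

theorem ProjectsSimply.ne {c : ℂ} {P : ℕ → V3} {m : ℕ} (h : ProjectsSimply c P m) {i j : ℕ}
    (hij : i < j) (hj : j < m) : obliqueProj c (P i) ≠ obliqueProj c (P j) := by
  simpa using h i j hij hj 0 (by simp) 0 (by simp)

theorem ProjectsSimply.injOn {c : ℂ} {P : ℕ → V3} {m : ℕ} (h : ProjectsSimply c P m)
    (hm : 2 ≤ m) (hP : P m = P 0) :
    InjOn (fun t => obliqueProj c (plPath P m t)) (Ico 0 1) := by
  have hm0 : (0 : ℝ) < m := by exact_mod_cast (by lia : 0 < m)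
  have hne : ∀ i < m, obliqueProj c (P i) ≠ obliqueProj c (P (i + 1)) := fun i hi => by
    rcases Nat.lt_or_ge (i + 1) m with h' | h'
    · exact h.ne (Nat.lt_succ_self i) h'
    · rw [show i + 1 = m by lia, hP]
      exact (h.ne (by lia : 0 < i) hi).symm
  have hrep : ∀ t ∈ Ico (0 : ℝ) 1, ∃ i < m, ∃ f ∈ Ico (0 : ℝ) 1, t * m = i + f ∧
      obliqueProj c (plPath P m t) =
        (1 - f) • obliqueProj c (P i) + f • obliqueProj c (P (i + 1)) := by
    intro t ht
    have h0 : 0 ≤ t * m := mul_nonneg ht.1 hm0.le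
    have h1 := Nat.floor_le h0
    have h2 := Nat.lt_floor_add_one (t * m)
    refine ⟨⌊t * m⌋₊, (Nat.floor_lt h0).2 (by nlinarith [ht.2]), t * m - ⌊t * m⌋₊,
      ⟨by linarith, by linarith⟩, by ring, ?_⟩
    rw [plPath_of_mem ⟨h1, h2.le⟩, map_add, map_smul, map_smul]
  intro s hs t ht hst
  obtain ⟨i, hi, f, hf, hsf, hsp⟩ := hrep s hs
  obtain ⟨j, hj, g, hg, htg, htp⟩ := hrep t ht
  simp only [hsp, htp] at hst
  rcases lt_trichotomy i j with hij | rfl | hij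
  · exact absurd hst (h i j hij hj f hf g hg)
  · have hfg : (f - g) • (obliqueProj c (P (i + 1)) - obliqueProj c (P i)) = 0 := by
      rw [← sub_eq_zero] at hst
      rw [← hst]
      module
    have hfg' : f = g := by
      rcases smul_eq_zero.1 hfg with h' | h'
      · linarith
      · exact absurd (sub_eq_zero.1 h').symm (hne i hi)
    exact mul_right_cancel₀ hm0.ne' (by rw [hsf, htg, hfg'])
  · exact absurd hst.symm (h j i hij hi g hg f hf)

/-- A closed piecewise linear curve with a simple planar projection is unknotted. -/
theorem ProjectsSimply.ambientIsotopic_unitCircle {c : ℂ} {P : ℕ → V3} {n : ℕ} (hn : 2 ≤ n)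
    (h : ProjectsSimply c P (2 * n)) (hP : P (2 * n) = P 0) :
    AmbientIsotopic (plPath P (2 * n) '' Icc 0 1) unitCircle := by
  set γ := plPath P (2 * n)
  have hγ : ContinuousOn γ (Icc 0 1) := continuousOn_plPath P (2 * n)
  have hinj := h.injOn (by lia) hP
  have hproj : Continuous (obliqueProj c) := (obliqueProj c).continuous_of_finiteDimensional
  have hγ01 : γ 0 = γ 1 := by
    have h0 : γ 0 = P 0 := by simp [γ, plPath]
    have h1 : γ 1 = P (2 * n) := by
      have := plPath_of_mem (P := P) (m := 2 * n) (i := 2 * n) (t := 1) ⟨by simp, by simp⟩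
      simpa using this
    rw [h0, h1, hP]
  let p : ℝ → ℂ := fun t => obliqueProj c (γ t)
  have hpc : ContinuousOn p (Icc 0 1) := hproj.comp_continuousOn hγ
  have hseg : ∀ (i : ℕ) (t : ℝ), t * (2 * n) ∈ Icc (i : ℝ) (i + 1) →
      p t = (1 - (t * (2 * n) - i)) • obliqueProj c (P i) +
        (t * (2 * n) - i) • obliqueProj c (P (i + 1)) := fun i t ht => by
    have := plPath_of_mem (P := P) (m := 2 * n) (i := i) (t := t) (by exact_mod_cast ht)
    simp only [p, γ, this, map_add, map_smul]
    push_cast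
    rfl
  obtain ⟨k, rfl⟩ : ∃ k, n = k + 2 := ⟨n - 2, by lia⟩
  have hk : (0 : ℝ) ≤ k := k.cast_nonneg
  push_cast at hseg
  have hk2 : (0 : ℝ) < k + 2 := by linarith
  have hdiv : (2 / (k + 2) : ℝ) * (k + 2) = 2 := by field_simp
  obtain ⟨e, he, he0, hpe⟩ := exists_continuousOn_factor
    (d := fun u => p ((1 + u) / 4) - p (1 - (1 + u) / 4)) (ε := 2 / (k + 2))
    (a := ((k + 2) / 2 : ℝ) • (obliqueProj c (P 1) - obliqueProj c (P (2 * k + 3))))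
    (b := ((k + 2) / 2 : ℝ) • (obliqueProj c (P (k + 1)) - obliqueProj c (P (k + 3))))
    ((hpc.comp (by fun_prop) fun u hu => ⟨by linarith [hu.1], by linarith [hu.2]⟩).sub
      (hpc.comp (by fun_prop) fun u hu => ⟨by linarith [hu.2], by linarith [hu.1]⟩))
    (fun u hu hd => by
      have := hinj ⟨by linarith [hu.1], by linarith [hu.2]⟩ ⟨by linarith [hu.2], by linarith [hu.1]⟩
        (sub_eq_zero.1 hd)
      linarith [hu.2])
    (by positivity)
    (smul_ne_zero (by positivity) (sub_ne_zero.2 (h.ne (by lia) (by lia))))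
    (smul_ne_zero (by positivity) (sub_ne_zero.2 (h.ne (by lia) (by lia))))
    (fun u hu => by
      have hu1 : (1 + u) * (k + 2) ≤ 2 := by
        refine (mul_le_mul_of_nonneg_right ?_ hk2.le).trans_eq hdiv
        linarith [hu.2]
      have hu0 : 0 ≤ (1 + u) * (k + 2) := mul_nonneg (by linarith [hu.1]) hk2.le
      rw [hseg 0 _ ⟨by push_cast; linarith, by push_cast; linarith⟩,
        hseg (2 * k + 3) _ ⟨by push_cast; linarith, by push_cast; linarith⟩,
        show 2 * k + 3 + 1 = 2 * (k + 2) by ring, hP]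
      push_cast
      module)
    (fun u hu => by
      have hu1 : (1 - u) * (k + 2) ≤ 2 := by
        refine (mul_le_mul_of_nonneg_right ?_ hk2.le).trans_eq hdiv
        linarith [hu.1]
      have hu0 : 0 ≤ (1 - u) * (k + 2) := mul_nonneg (by linarith [hu.2]) hk2.le
      rw [hseg (k + 1) _ ⟨by push_cast; linarith, by push_cast; linarith⟩,
        hseg (k + 2) _ ⟨by push_cast; linarith, by push_cast; linarith⟩]
      push_cast
      module)
  exact ambientIsotopic_unitCircle_of_loop hγ hγ01 (p := p) (fun _ => rfl) hinj he he0 hpe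


/-- The sums of consecutive entries of a list. -/
def neighbourSums : List (ℤ × ℤ) → List (ℤ × ℤ)
  | a :: b :: l => (a + b) :: neighbourSums (b :: l)
  | _ => []

theorem length_neighbourSums (L : List (ℤ × ℤ)) : (neighbourSums L).length = L.length - 1 := by
  induction L with
  | nil => rfl
  | cons a l ih => cases l <;> simp_all [neighbourSums]

theorem getD_neighbourSums (L : List (ℤ × ℤ)) (i : ℕ) (hi : i + 1 < L.length) :
    (neighbourSums L).getD i 0 = L.getD i 0 + L.getD (i + 1) 0 := by
  induction L generalizing i with
  | nil => simp at hi
  | cons a l ih =>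
    cases l with
    | nil => simp at hi
    | cons b l =>
      cases i with
      | zero => simp [neighbourSums]
      | succ i => simpa [neighbourSums] using ih i (by simpa using hi)

/-- Integral version of `dcLeft`, scaled by `2 ^ n`. -/
def scaledLeft (n : ℕ) (L : List (ℤ × ℤ)) : List (ℤ × ℤ) :=
  (List.range (n + 1)).map fun i => (2 : ℤ) ^ (n - i) • (neighbourSums^[i] L).getD 0 0

/-- Integral version of `dcRight`, scaled by `2 ^ n`. -/
def scaledRight (n : ℕ) (L : List (ℤ × ℤ)) : List (ℤ × ℤ) :=
  (List.range (n + 1)).map fun i => (2 : ℤ) ^ i • (neighbourSums^[n - i] L).getD i 0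

/-- Integral version of `subPolys`, scaled by `2 ^ (n * k)`. -/
def scaledSubPolys (n : ℕ) : ℕ → List (ℤ × ℤ) → List (List (ℤ × ℤ))
  | 0, L => [L]
  | k + 1, L => scaledSubPolys n k (scaledLeft n L) ++ scaledSubPolys n k (scaledRight n L)

/-- Integral version of `concatVerts`. -/
def latticeConcat (n : ℕ) (L : List (List (ℤ × ℤ))) (m : ℕ) : ℤ × ℤ :=
  (L.getD (m % (n * L.length) / n) []).getD (m % (n * L.length) % n) 0

/-- The embedding of `ℤ²` in the complex plane as the lattice with basis `1, I / 2`. -/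
def latticeEmb : ℤ × ℤ →+ ℂ where
  toFun a := ⟨a.1, a.2 / 2⟩
  map_zero' := by apply Complex.ext <;> simp
  map_add' a b := by apply Complex.ext <;> simp [add_div]

/-- The list `L` holds the points of the polygon `P 0, …, P n` in the plane, scaled by `s`. -/
def Represents (n : ℕ) (s : ℝ) (L : List (ℤ × ℤ)) (p : ℕ → ℂ) : Prop :=
  L.length = n + 1 ∧ ∀ i ≤ n, latticeEmb (L.getD i 0) = s • p i

theorem Represents.neighbourSums_iterate {n : ℕ} {s : ℝ} {L : List (ℤ × ℤ)} {c : ℂ} {P : ℕ → V3}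
    (h : Represents n s L fun i => obliqueProj c (P i)) {k : ℕ} (hk : k ≤ n) :
    Represents (n - k) (2 ^ k * s) (neighbourSums^[k] L) fun i => obliqueProj c (dcQ P k i) := by
  induction k with
  | zero => simpa [dcQ] using h
  | succ k ih =>
    obtain ⟨hl, hv⟩ := ih (by lia)
    rw [Function.iterate_succ_apply']
    refine ⟨by rw [length_neighbourSums, hl]; lia, fun i hi => ?_⟩
    rw [getD_neighbourSums _ _ (by lia), map_add, hv i (by lia), hv (i + 1) (by lia)]
    simp only [dcQ, map_smul, map_add]
    module

theorem Represents.scaledLeft {n : ℕ} {s : ℝ} {L : List (ℤ × ℤ)} {c : ℂ} {P : ℕ → V3}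
    (h : Represents n s L fun i => obliqueProj c (P i)) :
    Represents n (2 ^ n * s) (scaledLeft n L) fun i => obliqueProj c (dcLeft P i) := by
  refine ⟨by simp [_root_.scaledLeft], fun i hi => ?_⟩
  have h2 : (2 : ℝ) ^ n = 2 ^ (n - i) * 2 ^ i := by rw [← pow_add, Nat.sub_add_cancel hi]
  rw [_root_.scaledLeft, List.getD_eq_getElem _ _ (by simpa using Nat.lt_succ_of_le hi),
    List.getElem_map, List.getElem_range, map_zsmul,
    (h.neighbourSums_iterate hi).2 0 (Nat.zero_le _), ← Int.cast_smul_eq_zsmul ℝ, smul_smul, h2]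
  push_cast
  rw [mul_assoc]
  rfl

theorem Represents.scaledRight {n : ℕ} {s : ℝ} {L : List (ℤ × ℤ)} {c : ℂ} {P : ℕ → V3}
    (h : Represents n s L fun i => obliqueProj c (P i)) :
    Represents n (2 ^ n * s) (scaledRight n L) fun i => obliqueProj c (dcRight n P i) := by
  refine ⟨by simp [_root_.scaledRight], fun i hi => ?_⟩
  have h2 : (2 : ℝ) ^ n = 2 ^ i * 2 ^ (n - i) := by rw [← pow_add, Nat.add_sub_cancel' hi]
  rw [_root_.scaledRight, List.getD_eq_getElem _ _ (by simpa using Nat.lt_succ_of_le hi),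
    List.getElem_map, List.getElem_range, map_zsmul,
    (h.neighbourSums_iterate (Nat.sub_le n i)).2 i (by lia), ← Int.cast_smul_eq_zsmul ℝ,
    smul_smul, h2]
  push_cast
  rw [mul_assoc]
  rfl

theorem Represents.subPolys {n : ℕ} {s : ℝ} {L : List (ℤ × ℤ)} {c : ℂ} {P : ℕ → V3}
    (h : Represents n s L fun i => obliqueProj c (P i)) (k : ℕ) :
    List.Forall₂ (fun L' P' => Represents n (2 ^ (n * k) * s) L' fun i => obliqueProj c (P' i))
      (scaledSubPolys n k L) (subPolys n k P) := by
  induction k generalizing s L P with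
  | zero => simpa [scaledSubPolys, _root_.subPolys] using h
  | succ k ih =>
    have hs : (2 : ℝ) ^ (n * (k + 1)) * s = 2 ^ (n * k) * (2 ^ n * s) := by ring
    rw [hs]
    exact List.rel_append (ih h.scaledLeft) (ih h.scaledRight)

theorem latticeEmb_latticeConcat {n : ℕ} (hn : 0 < n) {s : ℝ} {c : ℂ} {L : List (List (ℤ × ℤ))}
    {Q : List (ℕ → V3)} (hL : L ≠ [])
    (h : List.Forall₂ (fun L' P => Represents n s L' fun i => obliqueProj c (P i)) L Q) (m : ℕ) :
    latticeEmb (latticeConcat n L m) = s • obliqueProj c (concatVerts n Q m) := by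
  have hm : m % (n * L.length) / n < L.length :=
    Nat.div_lt_of_lt_mul (Nat.mod_lt _ (Nat.mul_pos hn (List.length_pos_iff.2 hL)))
  have hlen := h.length_eq
  simp only [latticeConcat, concatVerts, ← hlen]
  rw [List.getD_eq_getElem L _ hm, List.getD_eq_getElem Q _ (hlen ▸ hm)]
  exact (h.get hm (hlen ▸ hm)).2 _ (Nat.mod_lt _ hn).le

/-- The signed area of the parallelogram spanned by `b - a` and `c - a`. -/
def cross (a b c : ℤ × ℤ) : ℤ := (b.1 - a.1) * (c.2 - a.2) - (b.2 - a.2) * (c.1 - a.1)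

/-- The inner product of `b - a` and `c - b`. -/
def dotAlong (a b c : ℤ × ℤ) : ℤ := (b.1 - a.1) * (c.1 - b.1) + (b.2 - a.2) * (c.2 - b.2)

/-- A sufficient condition for two segments without their second endpoints to be disjoint:
one of them lies on one side of the other, with the first endpoint strictly so, or a line through
the second endpoint of the first segment separates them. -/
def Separated (s t : (ℤ × ℤ) × (ℤ × ℤ)) : Prop :=
  (cross s.1 s.2 t.1 ≠ 0 ∧ 0 ≤ cross s.1 s.2 t.1 * cross s.1 s.2 t.2) ∨
  (cross t.1 t.2 s.1 ≠ 0 ∧ 0 ≤ cross t.1 t.2 s.1 * cross t.1 t.2 s.2) ∨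
  (s.1 ≠ s.2 ∧ 0 ≤ dotAlong s.1 s.2 t.1 ∧ 0 ≤ dotAlong s.1 s.2 t.2)

instance : DecidableRel Separated := fun s t => by unfold Separated; infer_instance

theorem ne_of_cross {a b c d : ℤ × ℤ} (h0 : cross a b c ≠ 0)
    (h : 0 ≤ cross a b c * cross a b d) (f : ℝ) {g : ℝ} (hg : g ∈ Ico (0 : ℝ) 1) :
    (1 - f) • latticeEmb a + f • latticeEmb b ≠ (1 - g) • latticeEmb c + g • latticeEmb d := by
  intro he
  have hre := congrArg Complex.re he
  have him := congrArg Complex.im he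
  simp [latticeEmb] at hre him
  have hu : (cross a b c : ℝ) ≠ 0 := by exact_mod_cast h0
  have huv : (0 : ℝ) ≤ cross a b c * cross a b d := by exact_mod_cast h
  have hz : (1 - g) * (cross a b c : ℝ) + g * cross a b d = 0 := by
    simp only [cross]
    push_cast
    linear_combination (b.2 - a.2 : ℝ) * hre - 2 * (b.1 - a.1 : ℝ) * him
  have h1 : 0 < (1 - g) * (cross a b c : ℝ) ^ 2 :=
    mul_pos (by linarith [hg.2]) (by positivity)
  have h2 := mul_nonneg hg.1 huv
  have h3 : (1 - g) * (cross a b c : ℝ) ^ 2 + g * (cross a b c * cross a b d) = 0 := by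
    linear_combination (cross a b c : ℝ) * hz
  linarith

theorem ne_of_dotAlong {a b c d : ℤ × ℤ} (h0 : a ≠ b) (hc : 0 ≤ dotAlong a b c)
    (hd : 0 ≤ dotAlong a b d) {f g : ℝ} (hf : f ∈ Ico (0 : ℝ) 1) (hg : g ∈ Ico (0 : ℝ) 1) :
    (1 - f) • latticeEmb a + f • latticeEmb b ≠ (1 - g) • latticeEmb c + g • latticeEmb d := by
  intro he
  have hre := congrArg Complex.re he
  have him := congrArg Complex.im he
  simp [latticeEmb] at hre him
  have hpos : 0 < ((b.1 - a.1 : ℤ) : ℝ) ^ 2 + ((b.2 - a.2 : ℤ) : ℝ) ^ 2 := by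
    by_cases h1 : b.1 - a.1 = 0
    · have h2 : b.2 - a.2 ≠ 0 := fun h2 => h0 (Prod.ext (by lia) (by lia))
      have : ((b.2 - a.2 : ℤ) : ℝ) ≠ 0 := by exact_mod_cast h2
      positivity
    · have : ((b.1 - a.1 : ℤ) : ℝ) ≠ 0 := by exact_mod_cast h1
      positivity
  have hc' : (0 : ℝ) ≤ dotAlong a b c := by exact_mod_cast hc
  have hd' : (0 : ℝ) ≤ dotAlong a b d := by exact_mod_cast hd
  have hz : (1 - g) * (dotAlong a b c : ℝ) + g * dotAlong a b d =
      -((1 - f) * (((b.1 - a.1 : ℤ) : ℝ) ^ 2 + ((b.2 - a.2 : ℤ) : ℝ) ^ 2)) := by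
    simp only [dotAlong]
    push_cast
    linear_combination -(b.1 - a.1 : ℝ) * hre - 2 * (b.2 - a.2 : ℝ) * him
  have h1 := mul_pos (by linarith [hf.2] : 0 < 1 - f) hpos
  have h2 := mul_nonneg (by linarith [hg.2] : 0 ≤ 1 - g) hc'
  have h3 := mul_nonneg hg.1 hd'
  linarith

theorem Separated.ne {s t : (ℤ × ℤ) × (ℤ × ℤ)} (h : Separated s t) {f g : ℝ}
    (hf : f ∈ Ico (0 : ℝ) 1) (hg : g ∈ Ico (0 : ℝ) 1) :
    (1 - f) • latticeEmb s.1 + f • latticeEmb s.2 ≠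
      (1 - g) • latticeEmb t.1 + g • latticeEmb t.2 := by
  rcases h with ⟨h0, h⟩ | ⟨h0, h⟩ | ⟨h0, hc, hd⟩
  · exact ne_of_cross h0 h f hg
  · exact (ne_of_cross h0 h g hf).symm
  · exact ne_of_dotAlong h0 hc hd hf hg

/-- The edges of the closed polygon with `m` vertices `v 0, v 1, …`. -/
def edges (v : ℕ → ℤ × ℤ) (m : ℕ) : List ((ℤ × ℤ) × (ℤ × ℤ)) :=
  (List.range m).map fun i => (v i, v (i + 1))

theorem projectsSimply_of_pairwise {v : ℕ → ℤ × ℤ} {m : ℕ} (h : (edges v m).Pairwise Separated)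
    {c : ℂ} {P : ℕ → V3} {s : ℝ} (hv : ∀ i, latticeEmb (v i) = s • obliqueProj c (P i)) :
    ProjectsSimply c P m := by
  intro i j hij hj f hf g hg he
  have hsep : Separated (v i, v (i + 1)) (v j, v (j + 1)) := by
    simpa [edges] using List.pairwise_iff_getElem.1 h i j (by simp [edges]; lia)
      (by simpa [edges] using hj) hij
  refine hsep.ne hf hg ?_
  simp only [hv]
  simpa only [smul_add, smul_comm s] using congrArg (s • ·) he

/-- The images of the vertices of `K0` under the oblique projection along `(2, 1, -1 / 2)`, in
lattice coordinates. -/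
def K0lattice : List (ℤ × ℤ) :=
  [(-18, 49), (175, -195), (-120, 40), (110, 56), (-120, 70), (160, -180), (-18, 49)]

theorem represents_K0lattice :
    Represents 6 1 K0lattice fun i => obliqueProj (-2 + Complex.I / 2) (vertsOf K0verts i) := by
  refine ⟨rfl, fun i hi => ?_⟩
  interval_cases i <;>
    (apply Complex.ext <;>
      simp [K0lattice, latticeEmb, obliqueProj, coords, vertsOf, K0verts, pt, Matrix.cons_val] <;>
      norm_num)

set_option maxRecDepth 100000 in
theorem pairwise_separated_edges :
    (edges (latticeConcat 6 (scaledSubPolys 6 4 K0lattice)) 96).Pairwise Separated := by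
  decide +kernel

/-- K₀,₄ (obtained from K₀ by 4 iterations of de Casteljau
subdivision at parameter 1/2) is the unknot: there is an ambient isotopy
between K₀,₄ and the round circle {(x,y,0) : x² + y² = 1}. -/
theorem K04_is_unknot :
    AmbientIsotopic (Ksub 4 (vertsOf K0verts) '' Icc 0 1) unitCircle := by
  have hrep : ∀ i, latticeEmb (latticeConcat 6 (scaledSubPolys 6 4 K0lattice) i) = _ :=
    latticeEmb_latticeConcat (by lia) (by simp [scaledSubPolys])
      (represents_K0lattice.subPolys 4)
  exact (projectsSimply_of_pairwise pairwise_separated_edges hrep).ambientIsotopic_unitCircle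
    (n := 48) (by lia) rfl
end
end
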